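/- arXiv:1412.8269 — 2 statements merged into one kernel-verified Lean document; each statement's English description precedes it below -/
import Mathlib

section
/- For any finite simplicial complex K, the total complex of the double complex N^{*,*}(K) (generated by σ⊗τ with σ ⊆ τ, σ, τ simplices of K, with differential Δ(σ⊗τ) = dσ⊗τ + (-1)^{|σ|} σ⊗δτ) has cohomology isomorphic to the simplicial cohomology H^*(K). -/
open Finset

/-- A finite abstract simplicial complex with vertices in `ℕ`. -/
structure SC where
  faces : Finset (Finset ℕ)
  down_closed : ∀ ⦃s t : Finset ℕ⦄, s ∈ faces → t ⊆ s → t ∈ faces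

namespace SC

/-- The vertex set of a simplicial complex. -/
def verts (K : SC) : Finset ℕ := K.faces.sup id

/-- The dimension of a simplicial complex (dimension of `{∅}` is `-1`). -/
def dim (K : SC) : ℤ := ((K.faces.sup Finset.card : ℕ) : ℤ) - 1

/-- The link of a simplex. -/
def link (K : SC) (σ : Finset ℕ) : SC where
  faces := K.faces.filter fun t => σ ∪ t ∈ K.faces ∧ Disjoint σ t
  down_closed := by
    intro s t hs hts
    simp only [mem_filter] at hs ⊢
    refine ⟨K.down_closed hs.1 hts, K.down_closed hs.2.1 (union_subset_union_right hts),
      hs.2.2.mono_right ?_⟩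
    exact_mod_cast hts

/-- `K₁` is a subcomplex of `K`. -/
def IsSub (K₁ K : SC) : Prop := K₁.faces ⊆ K.faces

/-- Union of two simplicial complexes. -/
def union (K L : SC) : SC where
  faces := K.faces ∪ L.faces
  down_closed := by
    intro s t hs hts
    rcases mem_union.mp hs with h | h
    · exact mem_union_left _ (K.down_closed h hts)
    · exact mem_union_right _ (L.down_closed h hts)

/-- Intersection of two simplicial complexes. -/
def inter (K L : SC) : SC where
  faces := K.faces ∩ L.faces
  down_closed := by
    intro s t hs hts
    rw [mem_inter] at hs ⊢
    exact ⟨K.down_closed hs.1 hts, L.down_closed hs.2 hts⟩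

/-- The join of two simplicial complexes. -/
def join (K L : SC) : SC where
  faces := (K.faces ×ˢ L.faces).image fun x => x.1 ∪ x.2
  down_closed := by
    intro s t hs hts
    simp only [mem_image, mem_product] at hs ⊢
    obtain ⟨⟨a, b⟩, ⟨ha, hb⟩, rfl⟩ := hs
    refine ⟨⟨t ∩ a, t \ a⟩, ⟨K.down_closed ha inter_subset_right,
      L.down_closed hb fun x hx => ?_⟩, ?_⟩
    · rcases mem_union.mp (hts (mem_sdiff.mp hx).1) with h | h
      · exact absurd h (mem_sdiff.mp hx).2
      · exact h
    · ext x
      simp only [mem_union, mem_inter, mem_sdiff]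
      constructor
      · rintro (⟨h, _⟩ | ⟨h, _⟩) <;> exact h
      · intro hx
        by_cases hxa : x ∈ a
        · exact Or.inl ⟨hx, hxa⟩
        · exact Or.inr ⟨hx, hxa⟩

end SC
namespace SC
open Finset

/-- The sign of a vertex `v` in a simplex, given by its position in the canonical ordering. -/
def psgn (v : ℕ) (s : Finset ℕ) : ℤ := (-1) ^ (s.filter fun u => u < v).card

variable (G : Type) [AddCommGroup G]

/-- The submodule of functions supported on a given set of indices. -/
def suppM {α : Type} (P : α → Prop) : Submodule ℤ (α → G) where
  carrier := {c | ∀ x, c x ≠ 0 → P x}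
  add_mem' := by
    intro a b ha hb x hx
    by_cases h : a x = 0
    · exact hb x (by simpa [h] using hx)
    · exact ha x h
  zero_mem' := fun x hx => absurd rfl hx
  smul_mem' := by
    intro z a ha x hx
    exact ha x fun h => hx (by simp [h])

end SC
namespace SC
open Finset

variable (G : Type) [AddCommGroup G]

/-- The unreduced simplicial coboundary (as a map on coefficient functions). -/
def cobF (K : SC) (c : Finset ℕ → G) : Finset ℕ → G := fun ρ =>
  if ρ ∈ K.faces then
    ∑ w ∈ ρ, if ρ.erase w = ∅ then 0 else psgn w ρ • c (ρ.erase w)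
  else 0

/-- The reduced simplicial coboundary. -/
def cobRF (K : SC) (c : Finset ℕ → G) : Finset ℕ → G := fun ρ =>
  if ρ ∈ K.faces then ∑ w ∈ ρ, psgn w ρ • c (ρ.erase w) else 0

/-- The unreduced simplicial coboundary as a linear map. -/
def cobL (K : SC) : (Finset ℕ → G) →ₗ[ℤ] (Finset ℕ → G) where
  toFun := cobF G K
  map_add' := by
    intro a b
    funext ρ
    simp only [cobF, Pi.add_apply]
    split_ifs with h
    · rw [← Finset.sum_add_distrib]
      refine Finset.sum_congr rfl fun w _ => ?_
      split_ifs with h2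
      · simp
      · simp [smul_add]
    · simp
  map_smul' := by
    intro z a
    funext ρ
    simp only [cobF, Pi.smul_apply, RingHom.id_apply]
    split_ifs with h
    · rw [Finset.smul_sum]
      refine Finset.sum_congr rfl fun w _ => ?_
      split_ifs with h2
      · simp
      · rw [smul_smul, smul_smul, mul_comm]
    · simp

/-- The reduced simplicial coboundary as a linear map. -/
def cobRL (K : SC) : (Finset ℕ → G) →ₗ[ℤ] (Finset ℕ → G) where
  toFun := cobRF G K
  map_add' := by
    intro a b
    funext ρ
    simp only [cobRF, Pi.add_apply]
    split_ifs with h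
    · rw [← Finset.sum_add_distrib]
      exact Finset.sum_congr rfl fun w _ => smul_add _ _ _
    · simp
  map_smul' := by
    intro z a
    funext ρ
    simp only [cobRF, Pi.smul_apply, RingHom.id_apply]
    split_ifs with h
    · rw [Finset.smul_sum]
      refine Finset.sum_congr rfl fun w _ => ?_
      rw [smul_smul, smul_smul, mul_comm]
    · simp

/-- Degree-`q` unreduced simplicial cochains of `K` with coefficients in `G`. -/
def Cgr (K : SC) (q : ℤ) : Submodule ℤ (Finset ℕ → G) :=
  suppM G fun s => s ∈ K.faces ∧ s ≠ ∅ ∧ (s.card : ℤ) = q + 1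

/-- Degree-`q` reduced simplicial cochains (the empty simplex sits in degree `-1`). -/
def CgrR (K : SC) (q : ℤ) : Submodule ℤ (Finset ℕ → G) :=
  suppM G fun s => s ∈ K.faces ∧ (s.card : ℤ) = q + 1

/-- The degree-`q` simplicial cohomology of `K` with coefficients in `G`. -/
abbrev coh (K : SC) (q : ℤ) :=
  ↥(Cgr G K q ⊓ LinearMap.ker (cobL G K)) ⧸
    Submodule.comap (Cgr G K q ⊓ LinearMap.ker (cobL G K)).subtype
      (Submodule.map (cobL G K) (Cgr G K (q - 1)))

/-- The degree-`q` reduced simplicial cohomology of `K` with coefficients in `G`. -/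
abbrev cohR (K : SC) (q : ℤ) :=
  ↥(CgrR G K q ⊓ LinearMap.ker (cobRL G K)) ⧸
    Submodule.comap (CgrR G K q ⊓ LinearMap.ker (cobRL G K)).subtype
      (Submodule.map (cobRL G K) (CgrR G K (q - 1)))

end SC
namespace SC
open Finset

/-- Pairs of simplices, indexing the double complex `N^{*,*}`. -/
abbrev Pr := Finset ℕ × Finset ℕ

variable (G : Type) [AddCommGroup G]

/-- The `(p,q)`-graded piece of the double complex `N^{*,*}(K)` spanned by `σ ⊗ τ`, `σ ⊆ τ`. -/
def Ngr (K : SC) (p q : ℤ) : Submodule ℤ (Pr → G) :=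
  suppM G fun x => x.1 ⊆ x.2 ∧ x.2 ∈ K.faces ∧ x.1 ≠ ∅ ∧
    (x.1.card : ℤ) = p + 1 ∧ (x.2.card : ℤ) = q + 1

/-- The `(p,q)`-graded piece of the reduced double complex `Ñ^{*,*}(K)`. -/
def NgrR (K : SC) (p q : ℤ) : Submodule ℤ (Pr → G) :=
  suppM G fun x => x.1 ⊆ x.2 ∧ x.2 ∈ K.faces ∧
    (x.1.card : ℤ) = p + 1 ∧ (x.2.card : ℤ) = q + 1

/-- The vertical differential `σ ⊗ τ ↦ (-1)^{|σ|} σ ⊗ δτ` (unreduced). -/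
def dvF (K : SC) (c : Pr → G) : Pr → G := fun x =>
  if x.2 ∈ K.faces ∧ x.1 ⊆ x.2 ∧ x.1 ≠ ∅ then
    ((-1 : ℤ) ^ x.1.card) •
      ∑ w ∈ x.2, if x.1 ⊆ x.2.erase w then psgn w x.2 • c (x.1, x.2.erase w) else 0
  else 0

/-- The horizontal differential `σ ⊗ τ ↦ dσ ⊗ τ` (unreduced). -/
def dhF (K : SC) (c : Pr → G) : Pr → G := fun x =>
  if x.2 ∈ K.faces ∧ x.1 ⊆ x.2 ∧ x.1 ≠ ∅ then
    ∑ v ∈ x.2 \ x.1, psgn v (insert v x.1) • c (insert v x.1, x.2)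
  else 0

/-- The vertical differential (reduced). -/
def dvRF (K : SC) (c : Pr → G) : Pr → G := fun x =>
  if x.2 ∈ K.faces ∧ x.1 ⊆ x.2 then
    ((-1 : ℤ) ^ x.1.card) •
      ∑ w ∈ x.2, if x.1 ⊆ x.2.erase w then psgn w x.2 • c (x.1, x.2.erase w) else 0
  else 0

/-- The horizontal differential (reduced). -/
def dhRF (K : SC) (c : Pr → G) : Pr → G := fun x =>
  if x.2 ∈ K.faces ∧ x.1 ⊆ x.2 then
    ∑ v ∈ x.2 \ x.1, psgn v (insert v x.1) • c (insert v x.1, x.2)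
  else 0

/-- The vertical differential as a linear map (unreduced). -/
def dvL (K : SC) : (Pr → G) →ₗ[ℤ] (Pr → G) where
  toFun := dvF G K
  map_add' := by
    intro a b
    funext x
    simp only [dvF, Pi.add_apply]
    split_ifs with h
    · rw [← smul_add, ← Finset.sum_add_distrib]
      congr 1
      refine Finset.sum_congr rfl fun w _ => ?_
      split_ifs with h2
      · simp [smul_add]
      · simp
    · simp
  map_smul' := by
    intro z a
    funext x
    simp only [dvF, Pi.smul_apply, RingHom.id_apply]
    split_ifs with h
    · rw [smul_comm z]
      congr 1
      rw [Finset.smul_sum]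
      refine Finset.sum_congr rfl fun w _ => ?_
      split_ifs with h2
      · rw [smul_smul, smul_smul, mul_comm]
      · simp
    · simp

/-- The horizontal differential as a linear map (unreduced). -/
def dhL (K : SC) : (Pr → G) →ₗ[ℤ] (Pr → G) where
  toFun := dhF G K
  map_add' := by
    intro a b
    funext x
    simp only [dhF, Pi.add_apply]
    split_ifs with h
    · rw [← Finset.sum_add_distrib]
      exact Finset.sum_congr rfl fun v _ => smul_add _ _ _
    · simp
  map_smul' := by
    intro z a
    funext x
    simp only [dhF, Pi.smul_apply, RingHom.id_apply]
    split_ifs with h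
    · rw [Finset.smul_sum]
      refine Finset.sum_congr rfl fun v _ => ?_
      rw [smul_smul, smul_smul, mul_comm]
    · simp

/-- The vertical differential as a linear map (reduced). -/
def dvRL (K : SC) : (Pr → G) →ₗ[ℤ] (Pr → G) where
  toFun := dvRF G K
  map_add' := by
    intro a b
    funext x
    simp only [dvRF, Pi.add_apply]
    split_ifs with h
    · rw [← smul_add, ← Finset.sum_add_distrib]
      congr 1
      refine Finset.sum_congr rfl fun w _ => ?_
      split_ifs with h2
      · simp [smul_add]
      · simp
    · simp
  map_smul' := by
    intro z a
    funext x
    simp only [dvRF, Pi.smul_apply, RingHom.id_apply]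
    split_ifs with h
    · rw [smul_comm z]
      congr 1
      rw [Finset.smul_sum]
      refine Finset.sum_congr rfl fun w _ => ?_
      split_ifs with h2
      · rw [smul_smul, smul_smul, mul_comm]
      · simp
    · simp

/-- The horizontal differential as a linear map (reduced). -/
def dhRL (K : SC) : (Pr → G) →ₗ[ℤ] (Pr → G) where
  toFun := dhRF G K
  map_add' := by
    intro a b
    funext x
    simp only [dhRF, Pi.add_apply]
    split_ifs with h
    · rw [← Finset.sum_add_distrib]
      exact Finset.sum_congr rfl fun v _ => smul_add _ _ _
    · simp
  map_smul' := by
    intro z a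
    funext x
    simp only [dhRF, Pi.smul_apply, RingHom.id_apply]
    split_ifs with h
    · rw [Finset.smul_sum]
      refine Finset.sum_congr rfl fun v _ => ?_
      rw [smul_smul, smul_smul, mul_comm]
    · simp

/-- The total differential `Δ(σ⊗τ) = dσ⊗τ + (-1)^{|σ|}σ⊗δτ` (unreduced). -/
def dL (K : SC) : (Pr → G) →ₗ[ℤ] (Pr → G) := dhL G K + dvL G K

/-- The total differential (reduced). -/
def dRL (K : SC) : (Pr → G) →ₗ[ℤ] (Pr → G) := dhRL G K + dvRL G K

/-- Cocycles for the `E₁`-page: `ker Δ_v` in bidegree `(p,q)`. -/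
def Z1 (K : SC) (p q : ℤ) : Submodule ℤ (Pr → G) :=
  Ngr G K p q ⊓ LinearMap.ker (dvL G K)

/-- Coboundaries for the `E₁`-page. -/
def B1 (K : SC) (p q : ℤ) : Submodule ℤ (Pr → G) :=
  Submodule.map (dvL G K) (Ngr G K p (q - 1)) ⊓ Ngr G K p q

/-- The `E₁`-page of the cohomeology spectral sequence in bidegree `(p,q)`. -/
abbrev E1 (K : SC) (p q : ℤ) :=
  ↥(Z1 G K p q) ⧸ Submodule.comap (Z1 G K p q).subtype (B1 G K p q)

/-- Reduced `E₁`-cocycles. -/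
def Z1R (K : SC) (p q : ℤ) : Submodule ℤ (Pr → G) :=
  NgrR G K p q ⊓ LinearMap.ker (dvRL G K)

/-- Reduced `E₁`-coboundaries. -/
def B1R (K : SC) (p q : ℤ) : Submodule ℤ (Pr → G) :=
  Submodule.map (dvRL G K) (NgrR G K p (q - 1)) ⊓ NgrR G K p q

/-- The `E₁`-page of the reduced cohomeology spectral sequence. -/
abbrev E1R (K : SC) (p q : ℤ) :=
  ↥(Z1R G K p q) ⧸ Submodule.comap (Z1R G K p q).subtype (B1R G K p q)

/-- `E₂`-cocycles: vertical cocycles whose horizontal differential is a vertical coboundary. -/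
def Z2 (K : SC) (p q : ℤ) : Submodule ℤ (Pr → G) :=
  Ngr G K p q ⊓ LinearMap.ker (dvL G K) ⊓
    Submodule.comap (dhL G K) (Submodule.map (dvL G K) (Ngr G K (p - 1) (q - 1)))

/-- `E₂`-coboundaries. -/
def B2 (K : SC) (p q : ℤ) : Submodule ℤ (Pr → G) :=
  (Submodule.map (dvL G K) (Ngr G K p (q - 1)) ⊔
    Submodule.map (dhL G K) (Ngr G K (p + 1) q ⊓ LinearMap.ker (dvL G K))) ⊓ Ngr G K p q

/-- The cohomeology group `𝓗^{p,q}(K; G)`: the `E₂`-page of the cohomeology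
spectral sequence in bidegree `(p,q)`. -/
abbrev HH (K : SC) (p q : ℤ) :=
  ↥(Z2 G K p q) ⧸ Submodule.comap (Z2 G K p q).subtype (B2 G K p q)

/-- Reduced `E₂`-cocycles. -/
def Z2R (K : SC) (p q : ℤ) : Submodule ℤ (Pr → G) :=
  NgrR G K p q ⊓ LinearMap.ker (dvRL G K) ⊓
    Submodule.comap (dhRL G K) (Submodule.map (dvRL G K) (NgrR G K (p - 1) (q - 1)))

/-- Reduced `E₂`-coboundaries. -/
def B2R (K : SC) (p q : ℤ) : Submodule ℤ (Pr → G) :=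
  (Submodule.map (dvRL G K) (NgrR G K p (q - 1)) ⊔
    Submodule.map (dhRL G K) (NgrR G K (p + 1) q ⊓ LinearMap.ker (dvRL G K))) ⊓ NgrR G K p q

/-- The reduced cohomeology group `𝓗̃^{p,q}(K; G)`. -/
abbrev HHR (K : SC) (p q : ℤ) :=
  ↥(Z2R G K p q) ⧸ Submodule.comap (Z2R G K p q).subtype (B2R G K p q)

/-- Total-degree-`n` part of the total complex of `N^{*,*}(K)`. -/
def Tgr (K : SC) (n : ℤ) : Submodule ℤ (Pr → G) :=
  suppM G fun x => x.1 ⊆ x.2 ∧ x.2 ∈ K.faces ∧ x.1 ≠ ∅ ∧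
    (x.2.card : ℤ) - (x.1.card : ℤ) = n

/-- Total-degree-`n` part of the total complex of `Ñ^{*,*}(K)`. -/
def TgrR (K : SC) (n : ℤ) : Submodule ℤ (Pr → G) :=
  suppM G fun x => x.1 ⊆ x.2 ∧ x.2 ∈ K.faces ∧
    (x.2.card : ℤ) - (x.1.card : ℤ) = n

/-- The degree-`n` cohomology of the total complex of `N^{*,*}(K)`. -/
abbrev TotH (K : SC) (n : ℤ) :=
  ↥(Tgr G K n ⊓ LinearMap.ker (dL G K)) ⧸
    Submodule.comap (Tgr G K n ⊓ LinearMap.ker (dL G K)).subtype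
      (Submodule.map (dL G K) (Tgr G K (n - 1)) ⊓ Tgr G K n)

/-- The degree-`n` cohomology of the total complex of `Ñ^{*,*}(K)`. -/
abbrev TotHR (K : SC) (n : ℤ) :=
  ↥(TgrR G K n ⊓ LinearMap.ker (dRL G K)) ⧸
    Submodule.comap (TgrR G K n ⊓ LinearMap.ker (dRL G K)).subtype
      (Submodule.map (dRL G K) (TgrR G K (n - 1)) ⊓ TgrR G K n)

/-- The filtration `F^p` of the total complex by first degree. -/
def Fil (p : ℤ) : Submodule ℤ (Pr → G) :=
  suppM G fun x => (x.1.card : ℤ) ≤ p + 1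

/-- The `E_∞`-term of the cohomeology spectral sequence in bidegree `(p,p)`:
the `p`-th graded piece of the filtration induced on `H^0` of the total complex. -/
abbrev Einf0 (K : SC) (p : ℤ) :=
  ↥(Tgr ℤ K 0 ⊓ LinearMap.ker (dL ℤ K) ⊓ Fil ℤ p) ⧸
    Submodule.comap (Tgr ℤ K 0 ⊓ LinearMap.ker (dL ℤ K) ⊓ Fil ℤ p).subtype
      ((Tgr ℤ K 0 ⊓ LinearMap.ker (dL ℤ K) ⊓ Fil ℤ (p - 1)) ⊔
        (Submodule.map (dL ℤ K) (Tgr ℤ K (-1)) ⊓ Tgr ℤ K 0 ⊓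
          LinearMap.ker (dL ℤ K) ⊓ Fil ℤ p))

end SC
namespace SC

/-! ### Signs and double sums -/

lemma psgn_insert_self (v : ℕ) (s : Finset ℕ) : psgn v (insert v s) = psgn v s := by
  simp [psgn, Finset.filter_insert]

lemma psgn_insert {u v : ℕ} {s : Finset ℕ} (hv : v ∉ s) :
    psgn u (insert v s) = psgn u s * if v < u then -1 else 1 := by
  unfold psgn
  rw [Finset.filter_insert]
  split_ifs with h
  · rw [card_insert_of_notMem (by simp [hv]), pow_succ]
  · simp

lemma psgn_eq_psgn_erase {u v : ℕ} {s : Finset ℕ} (hv : v ∈ s) :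
    psgn u s = psgn u (s.erase v) * if v < u then -1 else 1 := by
  conv_lhs => rw [← insert_erase hv]
  exact psgn_insert (notMem_erase v s)

lemma psgn_eq_one {m : ℕ} {s : Finset ℕ} (h : ∀ u ∈ s, m ≤ u) : psgn m s = 1 := by
  unfold psgn
  rw [filter_false_of_mem fun u hu => not_lt.mpr (h u hu)]
  simp

lemma sum_sum_erase_eq_zero (A : Finset ℕ) (F : ℕ → ℕ → ℤ)
    (hF : ∀ v ∈ A, ∀ u ∈ A, u ≠ v → F v u = -F u v) :
    ∑ v ∈ A, ∑ u ∈ A.erase v, F v u = 0 := by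
  have h1 : ∑ v ∈ A, ∑ u ∈ A.erase v, F v u = ∑ v ∈ A, ∑ u ∈ A.erase v, F u v :=
    sum_comm' fun x y => by simp only [mem_erase]; tauto
  have h2 : ∑ v ∈ A, ∑ u ∈ A.erase v, F v u = -∑ v ∈ A, ∑ u ∈ A.erase v, F u v := by
    rw [← sum_neg_distrib]
    refine sum_congr rfl fun v hv => ?_
    rw [← sum_neg_distrib]
    refine sum_congr rfl fun u hu => ?_
    exact hF v hv u (mem_of_mem_erase hu) (ne_of_mem_erase hu)
  omega

/-! ### The differentials of the double complex -/

variable {K : SC}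

lemma dhF_apply {c : Pr → ℤ} {σ τ : Finset ℕ} (hτ : τ ∈ K.faces) (hσ : σ ⊆ τ) (h0 : σ ≠ ∅) :
    dhF ℤ K c (σ, τ) = ∑ v ∈ τ \ σ, psgn v σ * c (insert v σ, τ) := by
  simp [dhF, hτ, hσ, h0, psgn_insert_self]

lemma dvF_apply {c : Pr → ℤ} {σ τ : Finset ℕ} (hτ : τ ∈ K.faces) (hσ : σ ⊆ τ) (h0 : σ ≠ ∅) :
    dvF ℤ K c (σ, τ) = (-1) ^ σ.card * ∑ w ∈ τ \ σ, psgn w τ * c (σ, τ.erase w) := by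
  simp only [dvF, hτ, hσ, h0, ne_eq, not_false_eq_true, and_self, if_true, smul_eq_mul]
  congr 1
  rw [← sum_filter]
  refine sum_congr ?_ fun _ _ => rfl
  ext w
  simp only [mem_filter, mem_sdiff, subset_erase, hσ, true_and]

lemma dhF_of_not {c : Pr → ℤ} {x : Pr} (h : ¬(x.2 ∈ K.faces ∧ x.1 ⊆ x.2 ∧ x.1 ≠ ∅)) :
    dhF ℤ K c x = 0 := if_neg h

lemma dvF_of_not {c : Pr → ℤ} {x : Pr} (h : ¬(x.2 ∈ K.faces ∧ x.1 ⊆ x.2 ∧ x.1 ≠ ∅)) :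
    dvF ℤ K c x = 0 := if_neg h

lemma dL_apply (c : Pr → ℤ) (x : Pr) : dL ℤ K c x = dhF ℤ K c x + dvF ℤ K c x := rfl

lemma sdiff_insert_eq_erase (v : ℕ) (σ τ : Finset ℕ) :
    τ \ insert v σ = (τ \ σ).erase v := by
  ext; simp only [mem_sdiff, mem_insert, mem_erase]; tauto

lemma erase_sdiff_eq_erase (w : ℕ) (σ τ : Finset ℕ) :
    τ.erase w \ σ = (τ \ σ).erase w := by
  ext; simp only [mem_sdiff, mem_erase]; tauto

lemma subset_erase_of_mem_sdiff {σ τ : Finset ℕ} {w : ℕ} (hσ : σ ⊆ τ) (hw : w ∈ τ \ σ) :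
    σ ⊆ τ.erase w :=
  subset_erase.mpr ⟨hσ, (mem_sdiff.mp hw).2⟩

lemma dhF_dhF (c : Pr → ℤ) : dhF ℤ K (dhF ℤ K c) = 0 := by
  funext ⟨σ, τ⟩
  by_cases h : τ ∈ K.faces ∧ σ ⊆ τ ∧ σ ≠ ∅
  swap
  · exact dhF_of_not h
  obtain ⟨hτ, hσ, h0⟩ := h
  rw [dhF_apply hτ hσ h0, Pi.zero_apply]
  trans ∑ v ∈ τ \ σ, ∑ u ∈ (τ \ σ).erase v,
      psgn v σ * (psgn u (insert v σ) * c (insert u (insert v σ), τ))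
  · refine sum_congr rfl fun v hv => ?_
    rw [dhF_apply hτ (insert_subset (mem_sdiff.mp hv).1 hσ) (insert_ne_empty _ _), mul_sum,
      sdiff_insert_eq_erase]
  · refine sum_sum_erase_eq_zero _ _ fun v hv u hu huv => ?_
    rw [psgn_insert (mem_sdiff.mp hv).2, psgn_insert (mem_sdiff.mp hu).2, insert_comm u v]
    rcases lt_or_gt_of_ne huv with h | h
    · rw [if_pos h, if_neg h.not_gt]; ring
    · rw [if_pos h, if_neg h.not_gt]; ring

lemma dvF_dvF (c : Pr → ℤ) : dvF ℤ K (dvF ℤ K c) = 0 := by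
  funext ⟨σ, τ⟩
  by_cases h : τ ∈ K.faces ∧ σ ⊆ τ ∧ σ ≠ ∅
  swap
  · exact dvF_of_not h
  obtain ⟨hτ, hσ, h0⟩ := h
  rw [dvF_apply hτ hσ h0, Pi.zero_apply]
  refine mul_eq_zero_of_right _ ?_
  trans ∑ w ∈ τ \ σ, ∑ u ∈ (τ \ σ).erase w,
      psgn w τ * ((-1) ^ σ.card * (psgn u (τ.erase w) * c (σ, (τ.erase w).erase u)))
  · refine sum_congr rfl fun w hw => ?_
    rw [dvF_apply (K.down_closed hτ (erase_subset _ _)) (subset_erase_of_mem_sdiff hσ hw) h0,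
      mul_sum, mul_sum, erase_sdiff_eq_erase]
  · refine sum_sum_erase_eq_zero _ _ fun w hw u hu huw => ?_
    rw [psgn_eq_psgn_erase (u := w) (mem_sdiff.mp hu).1,
      psgn_eq_psgn_erase (u := u) (mem_sdiff.mp hw).1, erase_right_comm (a := w)]
    rcases lt_or_gt_of_ne huw with h | h
    · rw [if_pos h, if_neg h.not_gt]; ring
    · rw [if_pos h, if_neg h.not_gt]; ring

lemma dhF_dvF (c : Pr → ℤ) : dhF ℤ K (dvF ℤ K c) = -dvF ℤ K (dhF ℤ K c) := by
  funext ⟨σ, τ⟩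
  by_cases h : τ ∈ K.faces ∧ σ ⊆ τ ∧ σ ≠ ∅
  swap
  · rw [Pi.neg_apply, dhF_of_not h, dvF_of_not h, neg_zero]
  obtain ⟨hτ, hσ, h0⟩ := h
  rw [Pi.neg_apply, dhF_apply hτ hσ h0, dvF_apply hτ hσ h0, mul_sum, ← sum_neg_distrib]
  trans ∑ v ∈ τ \ σ, ∑ w ∈ (τ \ σ).erase v,
      -((-1) ^ σ.card * (psgn w τ * (psgn v σ * c (insert v σ, τ.erase w))))
  · refine sum_congr rfl fun v hv => ?_
    rw [dvF_apply hτ (insert_subset (mem_sdiff.mp hv).1 hσ) (insert_ne_empty _ _), mul_sum,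
      mul_sum, sdiff_insert_eq_erase, card_insert_of_notMem (mem_sdiff.mp hv).2]
    exact sum_congr rfl fun w _ => by ring
  · rw [sum_comm' (t' := τ \ σ) (s' := fun w => (τ \ σ).erase w)
      fun x y => by simp only [mem_erase]; tauto]
    refine sum_congr rfl fun w hw => ?_
    rw [dhF_apply (K.down_closed hτ (erase_subset _ _)) (subset_erase_of_mem_sdiff hσ hw) h0,
      sum_neg_distrib, erase_sdiff_eq_erase, mul_sum, mul_sum]

lemma dL_dL (c : Pr → ℤ) : dL ℤ K (dL ℤ K c) = 0 := by
  have e1 : dL ℤ K (dL ℤ K c) = dL ℤ K (dhL ℤ K c) + dL ℤ K (dvL ℤ K c) := by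
    rw [← map_add]; rfl
  have e2 : dL ℤ K (dL ℤ K c) = (dhF ℤ K (dhF ℤ K c) + dvF ℤ K (dhF ℤ K c)) +
      (dhF ℤ K (dvF ℤ K c) + dvF ℤ K (dvF ℤ K c)) := e1
  rw [e2, dhF_dhF, dhF_dvF, dvF_dvF]
  abel

lemma Tgr_eq_zero {n : ℤ} {c : Pr → ℤ} (hc : c ∈ Tgr ℤ K n) {x : Pr}
    (h : ¬(x.2 ∈ K.faces ∧ x.1 ⊆ x.2 ∧ x.1 ≠ ∅)) : c x = 0 := by
  by_contra h0
  have := hc x h0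
  tauto

lemma dL_mem_Tgr {m n : ℤ} (hmn : m + 1 = n) {c : Pr → ℤ} (hc : c ∈ Tgr ℤ K m) :
    dL ℤ K c ∈ Tgr ℤ K n := by
  rintro ⟨σ, τ⟩ hx
  rw [dL_apply] at hx
  by_cases h : τ ∈ K.faces ∧ σ ⊆ τ ∧ σ ≠ ∅
  swap
  · rw [dhF_of_not h, dvF_of_not h] at hx
    exact absurd rfl hx
  obtain ⟨hτ, hσ, h0⟩ := h
  refine ⟨hσ, hτ, h0, ?_⟩
  by_contra hn
  refine hx ?_
  dsimp only at hn
  rw [dhF_apply hτ hσ h0, dvF_apply hτ hσ h0]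
  refine add_eq_zero_iff_eq_neg.mpr ?_
  rw [sum_eq_zero, sum_eq_zero, mul_zero, neg_zero]
  · intro w hw
    refine mul_eq_zero_of_right _ (by_contra fun h1 => ?_)
    have h2 := (hc _ h1).2.2.2
    have h3 := card_erase_add_one (mem_sdiff.mp hw).1
    dsimp only at h2
    omega
  · intro v hv
    refine mul_eq_zero_of_right _ (by_contra fun h1 => ?_)
    have h2 := (hc _ h1).2.2.2
    have h3 := card_insert_of_notMem (mem_sdiff.mp hv).2
    dsimp only at h2
    omega

/-! ### The augmentation `{v} ⊗ τ ↦ τ` -/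

/-- The augmentation from the total complex to the simplicial cochains, sending `{v} ⊗ τ` to `τ`
and `σ ⊗ τ` to `0` when `σ` has more than one vertex. -/
def augL : (Pr → ℤ) →ₗ[ℤ] (Finset ℕ → ℤ) where
  toFun c := fun τ => ∑ v ∈ τ, c ({v}, τ)
  map_add' _ _ := funext fun _ => sum_add_distrib
  map_smul' _ _ := funext fun _ => (mul_sum _ _ _).symm

lemma augL_apply (c : Pr → ℤ) (τ : Finset ℕ) : augL c τ = ∑ v ∈ τ, c ({v}, τ) := rfl

lemma augL_dL (c : Pr → ℤ) : augL (dL ℤ K c) = -cobL ℤ K (augL c) := by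
  funext τ
  rw [Pi.neg_apply]
  change _ = -cobF ℤ K (augL c) τ
  rw [augL_apply]
  by_cases hτ : τ ∈ K.faces
  swap
  · simp [dL_apply, dhF, dvF, cobF, hτ]
  simp only [dL_apply, sum_add_distrib]
  have hh : ∑ v ∈ τ, dhF ℤ K c ({v}, τ) = 0 := by
    trans ∑ v ∈ τ, ∑ u ∈ τ.erase v, psgn u {v} * c (insert u {v}, τ)
    · refine sum_congr rfl fun v hv => ?_
      rw [dhF_apply hτ (singleton_subset_iff.mpr hv) (singleton_ne_empty v), sdiff_singleton_eq_erase]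
    · refine sum_sum_erase_eq_zero _ _ fun v _ u _ huv => ?_
      rw [pair_comm u v]
      rcases lt_or_gt_of_ne huv with h | h
      · simp [psgn, filter_singleton, h, h.not_gt]
      · simp [psgn, filter_singleton, h, h.not_gt]
  have hv : ∑ v ∈ τ, dvF ℤ K c ({v}, τ) = -cobF ℤ K (augL c) τ := by
    trans ∑ v ∈ τ, ∑ w ∈ τ.erase v, -(psgn w τ * c ({v}, τ.erase w))
    · refine sum_congr rfl fun v hv => ?_
      rw [dvF_apply hτ (singleton_subset_iff.mpr hv) (singleton_ne_empty v),
        sdiff_singleton_eq_erase, sum_neg_distrib]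
      simp
    · rw [sum_comm' (t' := τ) (s' := fun w => τ.erase w)
        fun x y => by simp only [mem_erase]; tauto]
      simp only [cobF, hτ, if_true, sum_neg_distrib]
      congr 1
      refine sum_congr rfl fun w _ => ?_
      split_ifs with h
      · rw [h, sum_empty]
      · rw [augL_apply, smul_eq_mul, mul_sum]
  rw [hh, hv, zero_add]

lemma augL_mem_Cgr {n : ℤ} {c : Pr → ℤ} (hc : c ∈ Tgr ℤ K n) : augL c ∈ Cgr ℤ K n := by
  intro τ hτ
  obtain ⟨v, hv, hv0⟩ := exists_ne_zero_of_sum_ne_zero hτ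
  obtain ⟨-, h1, -, h2⟩ := hc _ hv0
  refine ⟨h1, ne_empty_of_mem hv, ?_⟩
  rw [card_singleton] at h2
  push_cast at h2
  linarith

/-! ### The section and the horizontal contraction given by the least vertex -/

/-- The least vertex of a simplex. -/
noncomputable def minV (τ : Finset ℕ) : ℕ := sInf (τ : Set ℕ)

lemma minV_mem {τ : Finset ℕ} (h : τ.Nonempty) : minV τ ∈ τ :=
  mem_coe.mp (Nat.sInf_mem (coe_nonempty.mpr h))

lemma minV_le {τ : Finset ℕ} {v : ℕ} (h : v ∈ τ) : minV τ ≤ v :=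
  Nat.sInf_le (mem_coe.mpr h)

/-- The section `τ ↦ {min τ} ⊗ τ` of the augmentation. -/
noncomputable def augSection (f : Finset ℕ → ℤ) : Pr → ℤ := fun x =>
  if x.1 = {minV x.2} then f x.2 else 0

lemma augSection_mem_Tgr {n : ℤ} {f : Finset ℕ → ℤ} (hf : f ∈ Cgr ℤ K n) :
    augSection f ∈ Tgr ℤ K n := by
  rintro ⟨σ, τ⟩ hx
  simp only [augSection, ne_eq, ite_eq_right_iff, not_forall] at hx
  obtain ⟨rfl, hx⟩ := hx
  obtain ⟨h1, h2, h3⟩ := hf _ hx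
  refine ⟨singleton_subset_iff.mpr (minV_mem (nonempty_iff_ne_empty.mpr h2)), h1,
    singleton_ne_empty _, ?_⟩
  simp [h3]

lemma augL_augSection {n : ℤ} {f : Finset ℕ → ℤ} (hf : f ∈ Cgr ℤ K n) :
    augL (augSection f) = f := by
  funext τ
  simp only [augL_apply, augSection, singleton_inj, sum_ite_eq']
  split_ifs with h
  · rfl
  · by_contra h0
    exact h (minV_mem (nonempty_iff_ne_empty.mpr (hf τ (Ne.symm h0)).2.1))

/-- The contraction `σ ⊗ τ ↦ ({min τ} ∪ σ) ⊗ τ` (zero if `min τ ∈ σ`). -/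
noncomputable def cone (c : Pr → ℤ) : Pr → ℤ := fun x =>
  if minV x.2 ∈ x.1 then c (x.1.erase (minV x.2), x.2) else 0

lemma cone_mem_Tgr {n : ℤ} {c : Pr → ℤ} (hc : c ∈ Tgr ℤ K n) : cone c ∈ Tgr ℤ K (n - 1) := by
  rintro ⟨σ, τ⟩ hx
  simp only [cone, ne_eq, ite_eq_right_iff, not_forall] at hx
  obtain ⟨hm, hx⟩ := hx
  obtain ⟨h1, h2, h3, h4⟩ := hc _ hx
  dsimp only at h1 h2 h3 h4
  have hτ : τ.Nonempty := (nonempty_iff_ne_empty.mpr h3).mono h1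
  refine ⟨?_, h2, ne_empty_of_mem hm, ?_⟩
  · rw [← insert_erase hm]
    exact insert_subset (minV_mem hτ) h1
  · have := card_erase_add_one hm
    dsimp only
    omega

lemma augL_cone {n : ℤ} {c : Pr → ℤ} (hc : c ∈ Tgr ℤ K n) : augL (cone c) = 0 := by
  funext τ
  refine sum_eq_zero fun v _ => ?_
  simp only [cone, mem_singleton]
  split_ifs with h
  · refine Tgr_eq_zero hc fun h1 => h1.2.2 ?_
    simp [h]
  · rfl

lemma dhF_cone {c : Pr → ℤ} {σ τ : Finset ℕ} (hτ : τ ∈ K.faces)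
    (hσ : σ ⊆ τ) (h0 : σ ≠ ∅) (hd : ∀ ρ, dhF ℤ K c (ρ, τ) = 0) (ha : augL c τ = 0) :
    dhF ℤ K (cone c) (σ, τ) = c (σ, τ) := by
  have hm : minV τ ∈ τ := minV_mem ((nonempty_iff_ne_empty.mpr h0).mono hσ)
  rw [dhF_apply hτ hσ h0]
  by_cases hmσ : minV τ ∈ σ
  swap
  · rw [sum_eq_single_of_mem (minV τ) (mem_sdiff.mpr ⟨hm, hmσ⟩)]
    · simp only [cone, mem_insert_self, if_true]
      rw [psgn_eq_one fun u hu => minV_le (hσ hu), erase_insert hmσ, one_mul]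
    · intro v _ hv
      simp [cone, hmσ, hv.symm]
  have hterm : ∀ v ∈ τ \ σ, psgn v σ * cone c (insert v σ, τ) =
      -(psgn v (σ.erase (minV τ)) * c (insert v (σ.erase (minV τ)), τ)) := by
    intro v hv
    obtain ⟨hvτ, hvσ⟩ := mem_sdiff.mp hv
    have hne : minV τ ≠ v := fun h => hvσ (h ▸ hmσ)
    rw [psgn_eq_psgn_erase hmσ, if_pos (lt_of_le_of_ne (minV_le hvτ) hne)]
    simp only [cone, mem_insert_of_mem hmσ, if_true]
    rw [erase_insert_of_ne hne.symm]
    ring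
  rw [sum_congr rfl hterm, sum_neg_distrib]
  have hsd : τ \ σ.erase (minV τ) = insert (minV τ) (τ \ σ) := by
    ext v
    simp only [mem_sdiff, mem_erase, mem_insert]
    by_cases hv : v = minV τ
    · simp [hv, hm]
    · simp [hv]
  have key : ∑ v ∈ τ \ σ.erase (minV τ),
      psgn v (σ.erase (minV τ)) * c (insert v (σ.erase (minV τ)), τ) = 0 := by
    by_cases he : σ.erase (minV τ) = ∅
    · rw [he, sdiff_empty]
      simpa [psgn, augL_apply] using ha
    · rw [← dhF_apply hτ ((erase_subset _ _).trans hσ) he]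
      exact hd _
  rw [hsd, sum_insert (by simp [hmσ]), insert_erase hmσ,
    psgn_eq_one fun u hu => minV_le (hσ (mem_of_mem_erase hu)), one_mul] at key
  linarith

lemma dvF_eq_zero {c : Pr → ℤ} {τ : Finset ℕ} (h : ∀ σ, ∀ w ∈ τ, c (σ, τ.erase w) = 0)
    (σ : Finset ℕ) : dvF ℤ K c (σ, τ) = 0 := by
  by_cases hx : τ ∈ K.faces ∧ σ ⊆ τ ∧ σ ≠ ∅
  · rw [dvF_apply hx.1 hx.2.1 hx.2.2, sum_eq_zero, mul_zero]
    exact fun w hw => by rw [h σ w (mem_sdiff.mp hw).1, mul_zero]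
  · exact dvF_of_not hx

/-- The kernel of the augmentation is acyclic. -/
lemma exists_dL_eq_of_augL_eq_zero {n : ℤ} {c : Pr → ℤ} (hc : c ∈ Tgr ℤ K n)
    (hd : dL ℤ K c = 0) (ha : augL c = 0) :
    ∃ b ∈ Tgr ℤ K (n - 1), augL b = 0 ∧ dL ℤ K b = c := by
  suffices H : ∀ k : ℕ, ∀ c ∈ Tgr ℤ K n, dL ℤ K c = 0 → augL c = 0 →
      (∀ x : Pr, x.2.card + k ≤ K.faces.sup card → c x = 0) →
      ∃ b ∈ Tgr ℤ K (n - 1), augL b = 0 ∧ dL ℤ K b = c from by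
    refine H (K.faces.sup card + 1) c hc hd ha fun x hx => ?_
    omega
  clear hc hd ha c
  intro k
  induction k with
  | zero =>
    intro c hc _ _ hx
    refine ⟨0, zero_mem _, map_zero _, ?_⟩
    rw [map_zero]
    funext x
    by_cases h : x.2 ∈ K.faces
    · exact (hx x (le_sup (f := card) h)).symm
    · exact (Tgr_eq_zero hc fun h1 => h h1.1).symm
  | succ k ih =>
    intro c hc hd ha hx
    have hcone := cone_mem_Tgr hc
    have hmem : c - dL ℤ K (cone c) ∈ Tgr ℤ K n :=
      sub_mem hc (dL_mem_Tgr (sub_add_cancel n 1) hcone)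
    obtain ⟨b, hb, hab, hdb⟩ := ih (c - dL ℤ K (cone c)) hmem
      (by rw [map_sub, hd, dL_dL, sub_zero])
      (by rw [map_sub, ha, augL_dL, augL_cone hc, map_zero, neg_zero, sub_zero])
      (by
        rintro ⟨σ, τ⟩ hk
        by_cases h : τ ∈ K.faces ∧ σ ⊆ τ ∧ σ ≠ ∅
        swap
        · exact Tgr_eq_zero hmem h
        have hlow : ∀ ρ, ∀ w ∈ τ, c (ρ, τ.erase w) = 0 := by
          intro ρ w hw
          refine hx _ ?_
          have := card_erase_add_one hw
          dsimp only at hk ⊢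
          omega
        have hdh : ∀ ρ, dhF ℤ K c (ρ, τ) = 0 := by
          intro ρ
          have := congrFun hd (ρ, τ)
          rwa [dL_apply, dvF_eq_zero hlow, add_zero] at this
        rw [Pi.sub_apply, dL_apply, dhF_cone h.1 h.2.1 h.2.2 hdh (congrFun ha τ),
          dvF_eq_zero, add_zero, sub_self]
        intro ρ w hw
        have := fun ρ => hlow ρ w hw
        simp [cone, this])
    refine ⟨b + cone c, add_mem hb hcone, ?_, ?_⟩
    · rw [map_add, hab, augL_cone hc, add_zero]
    · rw [map_add, hdb, sub_add_cancel]

/-- The map induced by the augmentation from total cocycles to simplicial cohomology. -/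
noncomputable def augCoh (K : SC) (n : ℤ) :
    ↥(Tgr ℤ K n ⊓ LinearMap.ker (dL ℤ K)) →ₗ[ℤ] coh ℤ K n :=
  (Submodule.mkQ _).comp <| augL.restrict fun c hc =>
    ⟨augL_mem_Cgr hc.1, by
      change cobL ℤ K (augL c) = 0
      rw [← neg_eq_zero, ← augL_dL, LinearMap.mem_ker.mp hc.2, map_zero]⟩

lemma augCoh_surjective (K : SC) (n : ℤ) : Function.Surjective (augCoh K n) := by
  intro y
  obtain ⟨⟨f, hf, hdf⟩, rfl⟩ := Submodule.mkQ_surjective _ y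
  have hs := augSection_mem_Tgr hf
  obtain ⟨b, hb, hab, hdb⟩ := exists_dL_eq_of_augL_eq_zero (dL_mem_Tgr rfl hs) (dL_dL _)
    (by rw [augL_dL, augL_augSection hf, LinearMap.mem_ker.mp hdf, neg_zero])
  rw [add_sub_cancel_right] at hb
  refine ⟨⟨augSection f - b, sub_mem hs hb, ?_⟩, ?_⟩
  · change dL ℤ K (augSection f - b) = 0
    rw [map_sub, hdb, sub_self]
  · refine congrArg (Submodule.mkQ _) (Subtype.ext ?_)
    change augL (augSection f - b) = f
    rw [map_sub, hab, augL_augSection hf, sub_zero]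

lemma ker_augCoh (K : SC) (n : ℤ) :
    LinearMap.ker (augCoh K n) =
      Submodule.comap (Tgr ℤ K n ⊓ LinearMap.ker (dL ℤ K)).subtype
        (Submodule.map (dL ℤ K) (Tgr ℤ K (n - 1)) ⊓ Tgr ℤ K n) := by
  ext ⟨c, hc, hdc⟩
  have hker : ⟨c, hc, hdc⟩ ∈ LinearMap.ker (augCoh K n) ↔
      augL c ∈ Submodule.map (cobL ℤ K) (Cgr ℤ K (n - 1)) :=
    Submodule.Quotient.mk_eq_zero _
  rw [hker]
  constructor
  · rintro ⟨f, hf, hfc⟩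
    have hs := augSection_mem_Tgr hf
    obtain ⟨b, hb, -, hdb⟩ := exists_dL_eq_of_augL_eq_zero
      (add_mem hc (dL_mem_Tgr (sub_add_cancel n 1) hs))
      (by rw [map_add, dL_dL, LinearMap.mem_ker.mp hdc, add_zero])
      (by rw [map_add, augL_dL, augL_augSection hf, hfc, add_neg_cancel])
    refine ⟨⟨b - augSection f, sub_mem hb hs, ?_⟩, hc⟩
    rw [map_sub, hdb, add_sub_cancel_right]
    rfl
  · rintro ⟨⟨b, hb, hbc⟩, -⟩
    refine ⟨-augL b, neg_mem (augL_mem_Cgr hb), ?_⟩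
    rw [map_neg, ← augL_dL, hbc]
    rfl

end SC
/-- The cohomology of the total complex of the double complex
`N^{*,*}(K)` is isomorphic to the simplicial cohomology `H^*(K)`. -/
theorem totH_iso_coh (K : SC) (n : ℤ) :
    Nonempty (SC.TotH ℤ K n ≃+ SC.coh ℤ K n) := by
  exact ⟨((Submodule.quotEquivOfEq _ _ (SC.ker_augCoh K n).symm).trans
    ((SC.augCoh K n).quotKerEquivOfSurjective (SC.augCoh_surjective K n))).toAddEquiv⟩
end

section
/- For a finite simplicial complex K, the E_1 term of the cohomeology spectral sequence satisfies E_1^{p,q}(K) ≅ ⊕_{|σ|=p+1} H̃^{q-p-1}(link_K σ), the sum over simplices σ of K with p+1 vertices, where H̃ denotes reduced simplicial cohomology. -/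
open Finset

namespace SC
open Finset

/-- The sign relating `σ ∪ ρ` to the concatenation of the disjoint simplices `σ` and `ρ`. -/
def shuffleSign (σ ρ : Finset ℕ) : ℤ := ∏ u ∈ ρ, psgn u σ

theorem psgn_mul_self (v : ℕ) (s : Finset ℕ) : psgn v s * psgn v s = 1 := by
  rw [psgn, ← mul_pow]
  simp

theorem psgn_union {σ ρ : Finset ℕ} (h : Disjoint σ ρ) (v : ℕ) :
    psgn v (σ ∪ ρ) = psgn v σ * psgn v ρ := by
  rw [psgn, psgn, psgn, ← pow_add, filter_union, card_union_of_disjoint]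
  exact disjoint_filter_filter h

theorem shuffleSign_mul_self (σ ρ : Finset ℕ) : shuffleSign σ ρ * shuffleSign σ ρ = 1 := by
  rw [shuffleSign, ← prod_mul_distrib]
  exact prod_eq_one fun u _ => psgn_mul_self u σ

theorem shuffleSign_mul_psgn_union {σ ρ : Finset ℕ} (h : Disjoint σ ρ) {w : ℕ} (hw : w ∈ ρ) :
    shuffleSign σ ρ * psgn w (σ ∪ ρ) = psgn w ρ * shuffleSign σ (ρ.erase w) := by
  rw [shuffleSign, shuffleSign, ← mul_prod_erase ρ _ hw, psgn_union h]
  linear_combination (psgn w ρ * ∏ u ∈ ρ.erase w, psgn u σ) * psgn_mul_self w σ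

theorem mem_link_faces {K : SC} {σ ρ : Finset ℕ} :
    ρ ∈ (K.link σ).faces ↔ σ ∪ ρ ∈ K.faces ∧ Disjoint σ ρ := by
  simp only [link, mem_filter, and_iff_right_iff_imp]
  exact fun h => K.down_closed h.1 subset_union_right

variable (G : Type) [AddCommGroup G]

/-- The component at `σ` of the isomorphism `N^{*,*}(K) ≅ ⊕_σ C̃^*(link_K σ)`: it sends
`σ ⊗ (σ ∪ ρ)` to `ρ`, up to sign. -/
def toLink (σ : Finset ℕ) : (Pr → G) →ₗ[ℤ] (Finset ℕ → G) where
  toFun c ρ := if Disjoint σ ρ then shuffleSign σ ρ • c (σ, σ ∪ ρ) else 0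
  map_add' a b := by
    funext ρ
    simp only [Pi.add_apply]
    split_ifs <;> simp
  map_smul' z a := by
    funext ρ
    simp only [Pi.smul_apply, RingHom.id_apply]
    split_ifs
    · exact smul_comm _ _ _
    · simp

variable {G}

theorem toLink_apply (σ : Finset ℕ) (c : Pr → G) (ρ : Finset ℕ) :
    toLink G σ c ρ = if Disjoint σ ρ then shuffleSign σ ρ • c (σ, σ ∪ ρ) else 0 := rfl

theorem toLink_dvL (K : SC) {σ : Finset ℕ} (hσ : σ ≠ ∅) (c : Pr → G) :
    toLink G σ (dvL G K c) = ((-1 : ℤ) ^ σ.card) • cobRL G (K.link σ) (toLink G σ c) := by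
  funext ρ
  change (if Disjoint σ ρ then shuffleSign σ ρ • dvF G K c (σ, σ ∪ ρ) else 0) =
    ((-1 : ℤ) ^ σ.card) • cobRF G (K.link σ) (toLink G σ c) ρ
  by_cases hd : Disjoint σ ρ
  · by_cases hK : σ ∪ ρ ∈ K.faces
    · simp only [hd, if_true, dvF, cobRF, mem_link_faces, hK, subset_union_left, hσ, ne_eq,
        not_false_eq_true, and_self]
      rw [smul_comm]
      congr 1
      rw [sum_union hd, sum_eq_zero (s := σ), zero_add, smul_sum]
      · refine sum_congr rfl fun w hw => ?_
        have hwσ : w ∉ σ := fun h => disjoint_left.mp hd h hw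
        have he : (σ ∪ ρ).erase w = σ ∪ ρ.erase w := by
          rw [erase_union_distrib, erase_eq_of_notMem hwσ]
        rw [he, if_pos subset_union_left, toLink_apply,
          if_pos (hd.mono_right (erase_subset w ρ)), smul_smul, smul_smul,
          shuffleSign_mul_psgn_union hd hw]
      · exact fun w hw => if_neg fun h => notMem_erase w _ (h hw)
    · simp [dvF, cobRF, mem_link_faces, hK]
  · simp [cobRF, mem_link_faces, hd]

theorem dvL_mem_Ngr {K : SC} {p q : ℤ} {c : Pr → G} (hc : c ∈ Ngr G K p (q - 1)) :
    dvL G K c ∈ Ngr G K p q := by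
  intro x hx
  change dvF G K c x ≠ 0 at hx
  unfold dvF at hx
  split_ifs at hx with h
  · obtain ⟨w, hw, hne⟩ := exists_ne_zero_of_sum_ne_zero fun h0 => hx (by rw [h0, smul_zero])
    split_ifs at hne with hs
    · obtain ⟨-, -, -, hp, hq⟩ := hc (x.1, x.2.erase w) fun h0 => hne (by rw [h0, smul_zero])
      have := card_erase_add_one hw
      refine ⟨h.2.1, h.1, h.2.2, hp, ?_⟩
      simp only at hq
      omega
    · exact absurd rfl hne
  · exact absurd rfl hx

theorem toLink_mem_CgrR {K : SC} {p q : ℤ} {c : Pr → G} (hc : c ∈ Ngr G K p q)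
    (σ : Finset ℕ) : toLink G σ c ∈ CgrR G (K.link σ) (q - p - 1) := by
  intro ρ hρ
  rw [toLink_apply] at hρ
  split_ifs at hρ with hd
  · obtain ⟨-, hK, -, hp, hq⟩ := hc _ fun h0 => hρ (by rw [h0, smul_zero])
    simp only [card_union_of_disjoint hd] at hp hq
    exact ⟨mem_link_faces.mpr ⟨hK, hd⟩, by push_cast at hq; omega⟩
  · exact absurd rfl hρ

theorem eq_zero_of_toLink_eq_zero {K : SC} {p q : ℤ} {c : Pr → G} (hc : c ∈ Ngr G K p q)
    (h : ∀ σ ∈ K.faces, σ ≠ ∅ → (σ.card : ℤ) = p + 1 → toLink G σ c = 0) : c = 0 := by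
  funext x
  by_contra hx
  obtain ⟨hs, hK, hne, hp, -⟩ := hc x hx
  have h0 := congrFun (h x.1 (K.down_closed hK hs) hne hp) (x.2 \ x.1)
  rw [toLink_apply, if_pos disjoint_sdiff, union_sdiff_of_subset hs] at h0
  apply hx
  have h1 := congrArg (shuffleSign x.1 (x.2 \ x.1) • ·) h0
  simpa only [smul_smul, shuffleSign_mul_self, one_smul, Pi.zero_apply, smul_zero] using h1

/-- The simplices of `K` of dimension `p`. -/
abbrev Simplices (K : SC) (p : ℤ) :=
  {σ : Finset ℕ // σ ∈ K.faces ∧ σ ≠ ∅ ∧ (σ.card : ℤ) = p + 1}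

theorem exists_toLink_eq (K : SC) (p q : ℤ) (b : Simplices K p → Finset ℕ → G)
    (hb : ∀ σ, b σ ∈ CgrR G (K.link σ.1) (q - p - 1)) :
    ∃ c ∈ Ngr G K p q, ∀ σ, toLink G σ.1 c = b σ := by
  classical
  refine ⟨fun x => if h : (x.1 ∈ K.faces ∧ x.1 ≠ ∅ ∧ (x.1.card : ℤ) = p + 1) ∧ x.1 ⊆ x.2 then
    shuffleSign x.1 (x.2 \ x.1) • b ⟨x.1, h.1⟩ (x.2 \ x.1) else 0, ?_, ?_⟩
  · intro x hx
    simp only at hx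
    split_ifs at hx with h
    · obtain ⟨hf, hcard⟩ := hb _ _ fun h0 => hx (by rw [h0, smul_zero])
      have hK := (mem_link_faces.mp hf).1
      simp only [union_sdiff_of_subset h.2] at hK
      have := card_sdiff_add_card_eq_card h.2
      exact ⟨h.2, hK, h.1.2.1, h.1.2.2, by have := h.1.2.2; omega⟩
    · exact absurd rfl hx
  · intro σ
    funext ρ
    rw [toLink_apply]
    by_cases hd : Disjoint σ.1 ρ
    · rw [if_pos hd, dif_pos ⟨σ.2, subset_union_left⟩]
      simp only [union_sdiff_cancel_left hd, smul_smul, shuffleSign_mul_self, one_smul]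
    · rw [if_neg hd]
      by_contra h0
      exact hd (mem_link_faces.mp (hb σ ρ (Ne.symm h0)).1).2

theorem toLink_mem_cocycles {K : SC} {p q : ℤ} {c : Pr → G} (hc : c ∈ Z1 G K p q)
    {σ : Finset ℕ} (hσ : σ ≠ ∅) :
    toLink G σ c ∈ CgrR G (K.link σ) (q - p - 1) ⊓ LinearMap.ker (cobRL G (K.link σ)) := by
  refine ⟨toLink_mem_CgrR hc.1 σ, LinearMap.mem_ker.mpr ?_⟩
  have h := toLink_dvL K hσ c
  rw [LinearMap.mem_ker.mp hc.2, map_zero] at h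
  have h1 := congrArg (((-1 : ℤ) ^ σ.card) • ·) h
  simpa only [smul_zero, smul_smul, ← mul_pow, neg_mul_neg, one_mul, one_pow, one_smul,
    eq_comm] using h1

variable (G)

/-- The map from vertical cocycles to the product of the cohomology groups of the links. -/
def cocyclesToLinks (K : SC) (p q : ℤ) :
    ↥(Z1 G K p q) →ₗ[ℤ] ((σ : Simplices K p) → cohR G (K.link σ.1) (q - p - 1)) :=
  LinearMap.pi fun σ => (Submodule.mkQ _).comp
    (((toLink G σ.1).comp (Z1 G K p q).subtype).codRestrict _ fun c =>
      toLink_mem_cocycles c.2 σ.2.2.1)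

variable {G}

theorem cocyclesToLinks_surjective (K : SC) (p q : ℤ) :
    Function.Surjective (cocyclesToLinks G K p q) := by
  intro y
  choose b hb using fun σ => Submodule.mkQ_surjective _ (y σ)
  obtain ⟨c, hc, hcb⟩ := exists_toLink_eq K p q (fun σ => (b σ).1) fun σ => (b σ).2.1
  have hker : dvL G K c = 0 := by
    refine eq_zero_of_toLink_eq_zero (dvL_mem_Ngr (q := q + 1) (by simpa using hc)) ?_
    intro σ hσ hne hp
    rw [toLink_dvL K hne, hcb ⟨σ, hσ, hne, hp⟩, LinearMap.mem_ker.mp (b ⟨σ, hσ, hne, hp⟩).2.2,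
      smul_zero]
  refine ⟨⟨c, hc, hker⟩, funext fun σ => ?_⟩
  rw [← hb σ]
  exact congrArg _ (Subtype.ext (hcb σ))

theorem ker_cocyclesToLinks (K : SC) (p q : ℤ) :
    LinearMap.ker (cocyclesToLinks G K p q) =
      Submodule.comap (Z1 G K p q).subtype (B1 G K p q) := by
  ext c
  have hiff : c ∈ LinearMap.ker (cocyclesToLinks G K p q) ↔ ∀ σ : Simplices K p,
      toLink G σ.1 c.1 ∈ Submodule.map (cobRL G (K.link σ.1))
        (CgrR G (K.link σ.1) (q - p - 1 - 1)) := by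
    rw [LinearMap.mem_ker, funext_iff]
    exact forall_congr' fun σ => Submodule.Quotient.mk_eq_zero _
  have hdeg : q - p - 1 - 1 = q - 1 - p - 1 := by ring
  rw [hiff, Submodule.mem_comap, hdeg]
  constructor
  · intro h
    choose b hb hbc using h
    obtain ⟨a, ha, hab⟩ := exists_toLink_eq K p (q - 1)
      (fun σ => ((-1 : ℤ) ^ σ.1.card) • b σ) fun σ => Submodule.smul_mem _ _ (hb σ)
    refine ⟨⟨a, ha, ?_⟩, c.2.1⟩
    rw [← sub_eq_zero]
    refine eq_zero_of_toLink_eq_zero (Submodule.sub_mem _ (dvL_mem_Ngr ha) c.2.1) ?_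
    intro σ hσ hne hp
    rw [map_sub, toLink_dvL K hne, hab ⟨σ, hσ, hne, hp⟩, map_smul, smul_smul, ← mul_pow,
      neg_mul_neg, one_mul, one_pow, one_smul, hbc ⟨σ, hσ, hne, hp⟩]
    exact sub_self _
  · rintro ⟨⟨a, ha, hac⟩, -⟩ σ
    refine ⟨((-1 : ℤ) ^ σ.1.card) • toLink G σ.1 a,
      Submodule.smul_mem _ _ (toLink_mem_CgrR ha σ.1), ?_⟩
    rw [map_smul, ← toLink_dvL K σ.2.2.1, hac]
    rfl

variable (G)

/-- The `E₁`-page is the product of the reduced cohomology groups of the links. -/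
noncomputable def E1EquivPi (K : SC) (p q : ℤ) :
    E1 G K p q ≃ₗ[ℤ] ((σ : Simplices K p) → cohR G (K.link σ.1) (q - p - 1)) :=
  (Submodule.quotEquivOfEq _ _ (ker_cocyclesToLinks K p q).symm).trans
    ((cocyclesToLinks G K p q).quotKerEquivOfSurjective (cocyclesToLinks_surjective K p q))

instance (K : SC) (p : ℤ) : Finite (Simplices K p) :=
  Set.Finite.subset K.faces.finite_toSet fun _ h => h.1

end SC
/-- The `E₁`-term of the cohomeology spectral sequence:
`E₁^{p,q}(K) ≅ ⊕_{|σ| = p+1} H̃^{q-p-1}(link_K σ)`. -/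
theorem E1_iso_links (K : SC) (p q : ℤ) :
    Nonempty (SC.E1 ℤ K p q ≃+
      DirectSum {σ : Finset ℕ // σ ∈ K.faces ∧ σ ≠ ∅ ∧ (σ.card : ℤ) = p + 1}
        fun σ => SC.cohR ℤ (K.link σ.1) (q - p - 1)) := by
  classical
  have := Fintype.ofFinite (SC.Simplices K p)
  exact ⟨(SC.E1EquivPi ℤ K p q).toAddEquiv.trans (DirectSum.addEquivProd _).symm⟩
end
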